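/- Let G be a simple graph with minimum degree at least 1. Then q(G) ≤ max over vertices u of G of ( d(u) + (1/d(u)) · Σ_{v ∈ Γ(u)} d(v) ), where Γ(u) is the set of neighbors of u and d denotes vertex degree. -/

import Mathlib

open Matrix BigOperators

noncomputable def edgeCount {V : Type*} (G : SimpleGraph V) : ℕ := Nat.card G.edgeSet

noncomputable def deg {V : Type*} (G : SimpleGraph V) (v : V) : ℕ := Nat.card (G.neighborSet v)

def HasPathOn {V : Type*} (G : SimpleGraph V) (l : ℕ) : Prop :=
  ∃ (u v : V) (p : G.Walk u v), p.IsPath ∧ p.support.length = l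

noncomputable def signlessLaplacian {V : Type*} [Fintype V] [DecidableEq V]
    (G : SimpleGraph V) : Matrix V V ℝ :=
  letI : DecidableRel G.Adj := Classical.decRel _
  Matrix.diagonal (fun v => (deg G v : ℝ)) + G.adjMatrix ℝ

theorem signlessLaplacian_isHermitian {V : Type*} [Fintype V] [DecidableEq V]
    (G : SimpleGraph V) : (signlessLaplacian G).IsHermitian := by
  letI : DecidableRel G.Adj := Classical.decRel _
  unfold signlessLaplacian
  refine (Matrix.isHermitian_diagonal _).add ?_
  rw [Matrix.IsHermitian, Matrix.conjTranspose_eq_transpose_of_trivial]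
  exact G.isSymm_adjMatrix

/-- The `Q`-index of a graph: the largest eigenvalue of its signless Laplacian. -/
noncomputable def qIndex {V : Type*} [Fintype V] [DecidableEq V] (G : SimpleGraph V) : ℝ :=
  ⨆ v, (signlessLaplacian_isHermitian G).eigenvalues v

noncomputable def adjMat {V : Type*} [Fintype V] (G : SimpleGraph V) : Matrix V V ℝ :=
  letI : DecidableRel G.Adj := Classical.decRel _
  G.adjMatrix ℝ

theorem adjMat_isHermitian {V : Type*} [Fintype V] (G : SimpleGraph V) :
    (adjMat G).IsHermitian := by
  letI : DecidableRel G.Adj := Classical.decRel _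
  unfold adjMat
  rw [Matrix.IsHermitian, Matrix.conjTranspose_eq_transpose_of_trivial]
  exact G.isSymm_adjMatrix

/-- The spectral radius `μ`: the largest eigenvalue of the adjacency matrix. -/
noncomputable def muIndex {V : Type*} [Fintype V] [DecidableEq V] (G : SimpleGraph V) : ℝ :=
  ⨆ v, (adjMat_isHermitian G).eigenvalues v

/-- `S_{n,k} = K_k ∨ \overline{K_{n-k}}`: the first `k` vertices form a clique joined to all. -/
def Snk (n k : ℕ) : SimpleGraph (Fin n) :=
  SimpleGraph.fromRel (fun i j => (i : ℕ) < k ∨ (j : ℕ) < k)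

/-- `S_{n,k}^+`: `S_{n,k}` plus one edge inside the independent set. -/
def SnkPlus (n k : ℕ) : SimpleGraph (Fin n) :=
  SimpleGraph.fromRel (fun i j => (i : ℕ) < k ∨ (j : ℕ) < k ∨ ((i : ℕ) = k ∧ (j : ℕ) = k + 1))

/-- `L_{t,k} = K_1 ∨ tK_k`: `t` cliques of order `k+1` sharing a common center `none`. -/
def LGraph (t k : ℕ) : SimpleGraph (Option (Fin t × Fin k)) :=
  SimpleGraph.fromRel (fun x y => x = none ∨ ∃ i a b, x = some (i, a) ∧ y = some (i, b))

/-- `K_1 ∨ (sK_k ∪ K_m)`. -/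
def K1JoinCliques (s k m : ℕ) : SimpleGraph (Option ((Fin s × Fin k) ⊕ Fin m)) :=
  SimpleGraph.fromRel (fun x y => x = none ∨
    (∃ i a b, x = some (Sum.inl (i, a)) ∧ y = some (Sum.inl (i, b))) ∨
    (∃ a b, x = some (Sum.inr a) ∧ y = some (Sum.inr b)))

/-- Two disjoint copies of `L_{s,k}` and `L_{t,k}` with their centers joined by an edge. -/
def DoubleL (s t k : ℕ) : SimpleGraph (Option (Fin s × Fin k) ⊕ Option (Fin t × Fin k)) :=
  SimpleGraph.fromRel (fun x y =>
    (∃ a b, x = Sum.inl a ∧ y = Sum.inl b ∧ (LGraph s k).Adj a b) ∨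
    (∃ a b, x = Sum.inr a ∧ y = Sum.inr b ∧ (LGraph t k).Adj a b) ∨
    (x = Sum.inl none ∧ y = Sum.inr none))

/-- `G` is (a copy of) a subgraph of `H`. -/
def IsSubgraphOf {V W : Type*} (G : SimpleGraph V) (H : SimpleGraph W) : Prop :=
  ∃ f : V ↪ W, ∀ a b, G.Adj a b → H.Adj (f a) (f b)

/-- `G` contains `m` pairwise disjoint edges. -/
def HasMatching {V : Type*} (G : SimpleGraph V) (m : ℕ) : Prop :=
  ∃ M : Finset (Sym2 V), M.card = m ∧ (∀ e ∈ M, e ∈ G.edgeSet) ∧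
    ∀ e ∈ M, ∀ f ∈ M, e ≠ f → ∀ v : V, ¬(v ∈ e ∧ v ∈ f)

/-- `G` is 2-connected: at least 3 vertices, and deleting any vertex leaves a connected graph. -/
def TwoConnected {V : Type*} [Fintype V] (G : SimpleGraph V) : Prop :=
  3 ≤ Fintype.card V ∧ ∀ v : V, (G.induce {w : V | w ≠ v}).Connected

/-- Weighted row sums bound the real eigenvalues of an entrywise nonnegative matrix. -/
theorem eigenvalue_le_of_mulVec_le {V : Type*} [Fintype V] {A : Matrix V V ℝ}
    (hA : ∀ i j, 0 ≤ A i j) {w : V → ℝ} (hw : ∀ i, 0 < w i) {c : ℝ}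
    (hc : ∀ i, (A *ᵥ w) i ≤ c * w i) {μ : ℝ} {x : V → ℝ} (hx : x ≠ 0)
    (hμ : A *ᵥ x = μ • x) : μ ≤ c := by
  obtain ⟨j, hj⟩ := Function.ne_iff.mp hx
  have : Nonempty V := ⟨j⟩
  obtain ⟨u, hu⟩ := Finite.exists_max (fun i => |x i| / w i)
  set M := |x u| / w u with hM
  have hMpos : 0 < M := lt_of_lt_of_le (div_pos (abs_pos.mpr hj) (hw j)) (hu j)
  have hxM : ∀ i, |x i| ≤ M * w i := fun i => (div_le_iff₀ (hw i)).mp (hu i)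
  have hxu : |x u| = M * w u := (div_mul_cancel₀ _ (hw u).ne').symm
  have key : μ * (M * w u) ≤ c * (M * w u) := by
    calc μ * (M * w u) = μ * |x u| := by rw [hxu]
      _ ≤ |μ| * |x u| := mul_le_mul_of_nonneg_right (le_abs_self μ) (abs_nonneg _)
      _ = |(A *ᵥ x) u| := by rw [hμ, Pi.smul_apply, smul_eq_mul, abs_mul]
      _ ≤ ∑ i, |A u i * x i| := Finset.abs_sum_le_sum_abs _ _
      _ ≤ ∑ i, M * (A u i * w i) := Finset.sum_le_sum fun i _ => by
          rw [abs_mul, abs_of_nonneg (hA u i), mul_left_comm]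
          exact mul_le_mul_of_nonneg_left (hxM i) (hA u i)
      _ = M * (A *ᵥ w) u := by rw [← Finset.mul_sum]; rfl
      _ ≤ M * (c * w u) := mul_le_mul_of_nonneg_left (hc u) hMpos.le
      _ = c * (M * w u) := mul_left_comm _ _ _
  exact le_of_mul_le_mul_right key (mul_pos hMpos (hw u))

theorem signlessLaplacian_nonneg {V : Type*} [Fintype V] [DecidableEq V] (G : SimpleGraph V)
    (i j : V) : 0 ≤ signlessLaplacian G i j := by
  simp only [signlessLaplacian, Matrix.add_apply, Matrix.diagonal_apply,
    SimpleGraph.adjMatrix_apply]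
  split_ifs <;> positivity

theorem signlessLaplacian_mulVec_apply {V : Type*} [Fintype V] [DecidableEq V]
    (G : SimpleGraph V) [DecidableRel G.Adj] (x : V → ℝ) (u : V) :
    (signlessLaplacian G *ᵥ x) u = deg G u * x u + ∑ v ∈ G.neighborFinset u, x v := by
  rw [signlessLaplacian, Matrix.add_mulVec, Pi.add_apply, Matrix.mulVec_diagonal,
    SimpleGraph.adjMatrix_mulVec_apply]
  congr!

/-- Merris-type bound: for a graph with minimum degree at least `1`,
`q(G) ≤ max_u ( d(u) + (1/d(u)) ∑_{v ∈ Γ(u)} d(v) )`. -/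
theorem stmt_19 {V : Type*} [Fintype V] [DecidableEq V] (G : SimpleGraph V)
    [DecidableRel G.Adj] (hδ : ∀ v, 1 ≤ deg G v) :
    qIndex G ≤ ⨆ u : V, ((deg G u : ℝ) +
      (1 / (deg G u : ℝ)) * ∑ v ∈ G.neighborFinset u, (deg G v : ℝ)) := by
  cases isEmpty_or_nonempty V
  · simp [qIndex]
  refine ciSup_le fun k => ?_
  have hpos : ∀ v, (0 : ℝ) < deg G v := fun v => Nat.cast_pos.mpr (hδ v)
  refine eigenvalue_le_of_mulVec_le (signlessLaplacian_nonneg G) hpos (fun u => ?_) ?_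
    ((signlessLaplacian_isHermitian G).mulVec_eigenvectorBasis k)
  · rw [signlessLaplacian_mulVec_apply, ← div_le_iff₀ (hpos u)]
    refine le_trans (le_of_eq ?_) (le_ciSup (Set.finite_range _).bddAbove u)
    have := (hpos u).ne'
    field_simp
  · intro h
    refine (signlessLaplacian_isHermitian G).eigenvectorBasis.orthonormal.ne_zero k ?_
    ext i
    exact congrFun h i
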